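/- arXiv:math/9903044 — 2 statements merged into one kernel-verified Lean document; each statement's English description precedes it below -/
import Mathlib

section
/- Let $K$ be a field, let $V$ and $W$ be $K$-vector spaces with $W$ finite dimensional, let $f : V \to W$ be a linear map, and let $z$ be a natural number with $\dim f(V) > z$. Let $(V_i)_{i \in I}$ be a family of subspaces of $V$ such that $V$ is generated by $\bigcup_{i} V_i$ (i.e. the supremum of the $V_i$ is all of $V$), and assume that for any pair of indices $i, j \in I$ there is a finite chain of indices $i = i_1, i_2, \dots, i_k = j$ such that for every $h$ one has $\dim f(V_{i_h} \cap V_{i_{h+1}}) \geq z$. Then there exists an index $i \in I$ with $\dim f(V_i) > z$. -/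
/-- A function whose values agree on related elements takes the same value at both ends of
a chain. -/
theorem List.IsChain.map_head_eq_map_getLast {α β : Type*} {R : α → α → Prop} (g : α → β)
    (hg : ∀ a b, R a b → g a = g b) {l : List α} (hl : l.IsChain R) {i j : α}
    (hi : l.head? = some i) (hj : l.getLast? = some j) : g i = g j := by
  induction l generalizing i with
  | nil => simp at hi
  | cons a t ih =>
    obtain rfl : a = i := by simpa using hi
    cases t with
    | nil =>
      obtain rfl : a = j := by simpa using hj
      rfl
    | cons b t =>
      rw [List.isChain_cons_cons] at hl
      exact (hg _ _ hl.1).trans (ih hl.2 rfl (by simpa using hj))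

/-- Lemma (3.1): if `f : V → W` is a linear map with `dim f(V) > z`, and `(V i)` is a family
of subspaces of `V` generating `V`, such that any two indices are linked by a chain along
which consecutive intersections have image of dimension `≥ z`, then some `V i` has image of
dimension `> z`. -/
theorem stmt_0 {K V W : Type*} [Field K] [AddCommGroup V] [Module K V]
    [AddCommGroup W] [Module K W] [FiniteDimensional K W]
    (f : V →ₗ[K] W) (z : ℕ)
    (hrank : z < Module.finrank K (LinearMap.range f))
    {I : Type*} (Vs : I → Submodule K V)
    (hgen : (⨆ i, Vs i) = ⊤)
    (hchain : ∀ i j : I, ∃ l : List I, l ≠ [] ∧ l.head? = some i ∧ l.getLast? = some j ∧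
      l.Chain' (fun a b => z ≤ Module.finrank K ((Vs a ⊓ Vs b).map f))) :
    ∃ i : I, z < Module.finrank K ((Vs i).map f) := by
  by_contra! hle
  have hadj : ∀ a b, z ≤ Module.finrank K ((Vs a ⊓ Vs b).map f) →
      (Vs a).map f = (Vs b).map f := fun a b hab =>
    (Submodule.eq_of_le_of_finrank_le (Submodule.map_mono inf_le_left)
      ((hle a).trans hab)).symm.trans
      (Submodule.eq_of_le_of_finrank_le (Submodule.map_mono inf_le_right) ((hle b).trans hab))
  have hrange : LinearMap.range f = ⨆ i, (Vs i).map f := by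
    rw [← Submodule.map_iSup, hgen, Submodule.map_top]
  rw [hrange] at hrank
  rcases isEmpty_or_nonempty I with _ | ⟨⟨i⟩⟩
  · rw [iSup_of_empty, finrank_bot] at hrank
    exact absurd hrank z.not_lt_zero
  · have hsup : ⨆ j, (Vs j).map f ≤ (Vs i).map f := iSup_le fun j => by
      obtain ⟨l, -, hi, hj, hl⟩ := hchain i j
      exact (List.IsChain.map_head_eq_map_getLast (fun a => (Vs a).map f)
        hadj hl hi hj).ge
    exact absurd ((Submodule.finrank_mono hsup).trans (hle i)) hrank.not_ge
end

section
/- Let $K$ be a field, let $V$ and $W$ be $K$-vector spaces with $W$ finite dimensional, let $f : V \to W$ be a linear map, and let $z$ be a natural number. Let $(V_i)_{i \in I}$ be a family of subspaces of $V$, indexed by a nonempty set $I$, such that $V$ is generated by $\bigcup_i V_i$ (i.e. the supremum of the $V_i$ is all of $V$), and assume that for any pair of indices $i, j \in I$ there is a finite chain of indices $i = i_1, i_2, \dots, i_k = j$ such that for every $h$ one has $\dim f(V_{i_h} \cap V_{i_{h+1}}) \geq z$. If $\dim f(V_i) \leq z$ for every $i \in I$, then $f(V_i) = f(V)$ for every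 $i \in I$; in particular $\dim f(V) \leq z$. -/
/-- A function that takes equal values on consecutive entries of a list takes the same value
at its first and last entries. -/
theorem List.IsChain.map_head?_eq_map_getLast? {α β : Type*} {R : α → α → Prop} {g : α → β}
    (hR : ∀ a b, R a b → g a = g b) :
    ∀ {l : List α}, l.IsChain R → l.head?.map g = l.getLast?.map g
  | [], _ => rfl
  | [_], _ => rfl
  | a :: b :: l, h => by
    rw [List.isChain_cons_cons] at h
    have ih := List.IsChain.map_head?_eq_map_getLast? hR h.2
    simpa [List.getLast?_cons_cons, hR a b h.1] using ih

/-- Two subspaces whose images have dimension at most `z` have the same image as soon as the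
image of their intersection has dimension at least `z`. -/
theorem Submodule.map_eq_map_of_le_finrank_map_inf {K V W : Type*} [Field K] [AddCommGroup V]
    [Module K V] [AddCommGroup W] [Module K W] [FiniteDimensional K W] (f : V →ₗ[K] W) {z : ℕ}
    {A B : Submodule K V} (hA : Module.finrank K (A.map f) ≤ z)
    (hB : Module.finrank K (B.map f) ≤ z) (hAB : z ≤ Module.finrank K ((A ⊓ B).map f)) :
    A.map f = B.map f :=
  (Submodule.eq_of_le_of_finrank_le (Submodule.map_mono inf_le_left) (hA.trans hAB)).symm.trans
    (Submodule.eq_of_le_of_finrank_le (Submodule.map_mono inf_le_right) (hB.trans hAB))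

/-- If `(V i)` is a family of subspaces of `V`, indexed by a nonempty set, generating `V`,
such that any two indices are linked by a chain along which consecutive intersections have
image of dimension `≥ z`, and every `V i` has image of dimension `≤ z` under `f`, then
`f(V i) = f(V)` for every `i`; in particular `dim f(V) ≤ z`. -/
theorem stmt_3 {K V W : Type*} [Field K] [AddCommGroup V] [Module K V]
    [AddCommGroup W] [Module K W] [FiniteDimensional K W]
    (f : V →ₗ[K] W) (z : ℕ)
    {I : Type*} [Nonempty I] (Vs : I → Submodule K V)
    (hgen : (⨆ i, Vs i) = ⊤)
    (hchain : ∀ i j : I, ∃ l : List I, l ≠ [] ∧ l.head? = some i ∧ l.getLast? = some j ∧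
      l.Chain' (fun a b => z ≤ Module.finrank K ((Vs a ⊓ Vs b).map f)))
    (hle : ∀ i : I, Module.finrank K ((Vs i).map f) ≤ z) :
    (∀ i : I, (Vs i).map f = LinearMap.range f) ∧
      Module.finrank K (LinearMap.range f) ≤ z := by
  have heq (i j : I) : (Vs i).map f = (Vs j).map f := by
    obtain ⟨l, -, hi, hj, hl⟩ := hchain i j
    have h := List.IsChain.map_head?_eq_map_getLast? (g := fun i => (Vs i).map f)
      (fun a b hab => Submodule.map_eq_map_of_le_finrank_map_inf f (hle a) (hle b) hab) hl
    simpa [hi, hj] using h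
  have hrange (i : I) : (Vs i).map f = LinearMap.range f := by
    rw [LinearMap.range_eq_map, ← hgen, Submodule.map_iSup]
    simp [fun j => heq j i]
  obtain ⟨i⟩ := ‹Nonempty I›
  exact ⟨hrange, hrange i ▸ hle i⟩
end
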